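/- Let 0 → S →^h S₀ →^{h⁰} S₁ →^{h¹} ⋯ →^{h^{p−1}} S_p →^{h^p} S_{p+1}, p > 1, be an exact sequence of sheaves of Abelian groups over a paracompact topological space Z in which the sheaves S_q for 0 ≤ q < p are acyclic. Then, for 0 ≤ q ≤ p, the q-th cohomology group of the cochain complex of global sections 0 → Γ(Z,S) → Γ(Z,S₀) → Γ(Z,S₁) → ⋯ → Γ(Z,S_p) → Γ(Z,S_{p+1}) is isomorphic to the sheaf cohomology group H^q(Z,S) of Z with coefficients in S. -/

import Mathlib

open CategoryTheory

/-!
**Abstract de Rham theorem** (minor generalization, Theorem 24 of the paper).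

Let `Z` be a paracompact topological space, and let
`0 → S →^h S₀ →^{h⁰} S₁ →^{h¹} ⋯ →^{h^{p−1}} S_p →^{h^p} S_{p+1}`, `p > 1`,
be an exact sequence of sheaves of Abelian groups over `Z` in which the
sheaves `S_q`, `0 ≤ q < p`, are acyclic (i.e. their sheaf cohomology
`H^{j>0}(Z, S_q)` vanishes).  Then, for `0 ≤ q ≤ p`, the `q`-th cohomology
group of the cochain complex of global sections
`0 → Γ(Z,S) → Γ(Z,S₀) → Γ(Z,S₁) → ⋯ → Γ(Z,S_p) → Γ(Z,S_{p+1})`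
is isomorphic to the sheaf cohomology group `H^q(Z,S)`.

We formalize this in its natural generality for derived functors: the abelian
category `C` of sheaves of Abelian groups on the paracompact space `Z` (which
has enough injectives) is replaced by an abelian category `C` with enough
injectives, the left exact global sections functor `Γ(Z, ·)` by an additive
left exact functor `G : C ⥤ D` to an abelian category `D`, and the sheaf
cohomology `H^q(Z, ·)` by the right derived functors `G.rightDerived q`
(for the global sections functor these are exactly the sheaf cohomology
groups).  Since `h` is a monomorphism and `G` is left exact, `G.obj S` is
identified with the kernel of `G.map (f 0)`, so the `q`-th cohomology of the
complex of global sections above is the `q`-th homology of the cochain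
complex `G.obj (S' 0) → G.obj (S' 1) → ⋯` (extended by zero maps beyond
degree `p + 1`, which does not affect the cohomology in degrees `≤ p`).
-/

/-- The cochain complex of global sections
`Γ(S₀) → Γ(S₁) → ⋯ → Γ(S_{p+1}) → 0 → ⋯` associated with a sequence of
sheaves `S'` with maps `f i : S' i ⟶ S' (i+1)` whose consecutive composites
vanish up to degree `p` (the maps beyond degree `p` are replaced by zero,
the original sequence ending at `S_{p+1}`). -/
noncomputable def globalSectionsComplex
    {C : Type*} [Category C] [Abelian C]
    {D : Type*} [Category D] [Abelian D]
    (G : C ⥤ D) [G.Additive]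
    (p : ℕ) (S' : ℕ → C) (f : ∀ i, S' i ⟶ S' (i + 1))
    (hw : ∀ i, i + 1 ≤ p → f i ≫ f (i + 1) = 0) :
    CochainComplex D ℕ :=
  CochainComplex.of (fun q => G.obj (S' q))
    (fun q => if q ≤ p then G.map (f q) else 0)
    (by
      intro q
      by_cases h1 : q ≤ p <;> by_cases h2 : q + 1 ≤ p <;>
        simp only [h1, h2, if_true, if_false, Limits.comp_zero, Limits.zero_comp]
      rw [← G.map_comp, hw q h2, G.map_zero])

section

open Category Limits

section

variable {C : Type*} [Category C] [Abelian C]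

lemma homology_iso_cokernel_of_kernel (K : CochainComplex C ℕ) (n : ℕ) {Z : C}
    (a : K.X n ⟶ Z) (i : Z ⟶ K.X (n + 1)) (hmono : Mono i) (hai : a ≫ i = K.d n (n + 1))
    (d : K.X (n + 1) ⟶ K.X (n + 2)) (hd : K.d (n + 1) (n + 2) = d) (wi : i ≫ d = 0)
    (hi : (ShortComplex.mk i d wi).Exact) :
    Nonempty (K.homology (n + 1) ≅ cokernel a) := by
  subst hd
  have w : K.d n (n + 1) ≫ K.d (n + 1) (n + 2) = 0 := by simp
  have hlift : hi.fIsKernel.lift (KernelFork.ofι (K.d n (n + 1)) w) = a := by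
    rw [← cancel_mono i, hai]
    exact hi.fIsKernel.fac (KernelFork.ofι (K.d n (n + 1)) w) WalkingParallelPair.zero
  let data : (K.sc' n (n + 1) (n + 2)).LeftHomologyData :=
    { K := Z
      H := cokernel (hi.fIsKernel.lift (KernelFork.ofι (K.d n (n + 1)) w))
      i := i
      π := cokernel.π _
      wi := wi
      hi := hi.fIsKernel
      wπ := cokernel.condition _
      hπ := cokernelIsCokernel _ }
  exact ⟨K.homologyIsoSc' n (n + 1) (n + 2) (by simp) (by simp) ≪≫ data.homologyIso ≪≫
    cokernelIsoOfEq hlift⟩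

lemma homology_zero_iso_of_kernel (K : CochainComplex C ℕ) {Z : C} (i : Z ⟶ K.X 0)
    (hmono : Mono i) (d : K.X 0 ⟶ K.X 1) (hd : K.d 0 1 = d) (wi : i ≫ d = 0)
    (hi : (ShortComplex.mk i d wi).Exact) : Nonempty (K.homology 0 ≅ Z) := by
  subst hd
  let data : (K.sc' 0 0 1).LeftHomologyData :=
    .ofIsLimitKernelFork _ (K.shape _ _ (by simp)) _ hi.fIsKernel
  exact ⟨K.homologyIsoSc' 0 0 1 (by simp) (by simp) ≪≫ data.homologyIso⟩

lemma shortExact_kernelLift_of_exact {S : ShortComplex C} (hS : S.Exact) :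
    (ShortComplex.mk (kernel.ι S.f) (kernel.lift S.g S.f S.zero)
      (by simp [← cancel_mono (kernel.ι S.g)])).ShortExact := by
  have : Epi (kernel.lift S.g S.f S.zero) := hS.epi_kernelLift
  refine ⟨?_⟩
  let φ : ShortComplex.mk (kernel.ι S.f) (kernel.lift S.g S.f S.zero)
      (by simp [← cancel_mono (kernel.ι S.g)]) ⟶
      ShortComplex.mk (kernel.ι S.f) S.f (kernel.condition _) :=
    { τ₁ := 𝟙 _
      τ₂ := 𝟙 _
      τ₃ := kernel.ι S.g }
  have : Mono φ.τ₃ := inferInstanceAs (Mono (kernel.ι S.g))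
  have : Epi φ.τ₁ := inferInstanceAs (Epi (𝟙 _))
  have : IsIso φ.τ₂ := inferInstanceAs (IsIso (𝟙 _))
  exact (ShortComplex.exact_iff_of_epi_of_isIso_of_mono φ).2 (ShortComplex.exact_kernel _)

lemma shortExact_biprod_of_shortExact {S T : ShortComplex C} (hS : S.ShortExact)
    (hT : T.ShortExact) (φ : S ⟶ T) [IsIso φ.τ₁] :
    (ShortComplex.mk (biprod.lift φ.τ₂ S.g) (biprod.desc T.g (-φ.τ₃))
      (by simp [φ.comm₂₃])).ShortExact := by
  have := hS.mono_f
  have := hT.mono_f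
  have := hS.epi_g
  have := hT.epi_g
  have hmono : Mono (biprod.lift φ.τ₂ S.g) := by
    refine Preadditive.mono_of_cancel_zero _ fun {A} x hx => ?_
    have h₁ : x ≫ φ.τ₂ = 0 := by simpa using hx =≫ biprod.fst
    have h₂ : x ≫ S.g = 0 := by simpa using hx =≫ biprod.snd
    obtain ⟨y, rfl⟩ : ∃ y, y ≫ S.f = x := ⟨hS.exact.lift x h₂, hS.exact.lift_f x h₂⟩
    have : y ≫ φ.τ₁ ≫ T.f = 0 := by simpa [φ.comm₁₂] using h₁
    simp [zero_of_comp_mono (φ.τ₁ ≫ T.f) this]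
  have hexact : (ShortComplex.mk (biprod.lift φ.τ₂ S.g) (biprod.desc T.g (-φ.τ₃))
      (by simp [φ.comm₂₃])).Exact := by
    rw [ShortComplex.exact_iff_exact_up_to_refinements]
    intro A x hx
    dsimp at x hx ⊢
    have hx' : x ≫ biprod.fst ≫ T.g = x ≫ biprod.snd ≫ φ.τ₃ := by
      simpa [biprod.desc_eq, sub_eq_zero, ← sub_eq_add_neg] using hx
    obtain ⟨A', π, _, y, hy⟩ := surjective_up_to_refinements_of_epi S.g (x ≫ biprod.snd)
    have hz : (π ≫ x ≫ biprod.fst - y ≫ φ.τ₂) ≫ T.g = 0 := by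
      simp only [Preadditive.sub_comp, assoc, hx', φ.comm₂₃]
      rw [← reassoc_of% hy, sub_self]
    have hl := hT.exact.lift_f _ hz
    set z := hT.exact.lift _ hz
    refine ⟨A', π, inferInstance, y + z ≫ inv φ.τ₁ ≫ S.f, ?_⟩
    ext
    · simp [← φ.comm₁₂, hl]
    · simpa using hy
  exact
    { exact := hexact
      mono_f := hmono
      epi_g := epi_of_epi_fac (biprod.inl_desc T.g (-φ.τ₃)) }

lemma isPullback_of_shortExact {S T : ShortComplex C} (hS : S.ShortExact) (hT : T.ShortExact)
    (φ : S ⟶ T) [IsIso φ.τ₁] : IsPullback φ.τ₂ S.g T.g φ.τ₃ := by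
  have sq : CommSq φ.τ₂ S.g T.g φ.τ₃ := ⟨φ.comm₂₃⟩
  have h := shortExact_biprod_of_shortExact hS hT φ
  have := h.mono_f
  exact ⟨sq, ⟨sq.isLimitEquivIsLimitKernelFork.symm h.exact.fIsKernel⟩⟩

lemma shortExact_cokernel_comp {S : ShortComplex C} (hS : S.ShortExact) {J : C} (i : S.X₂ ⟶ J)
    [Mono i] :
    ∃ (u : S.X₃ ⟶ cokernel (S.f ≫ i)) (v : cokernel (S.f ≫ i) ⟶ cokernel i)
      (w : u ≫ v = 0), (ShortComplex.mk u v w).ShortExact ∧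
        cokernel.π (S.f ≫ i) ≫ v = cokernel.π i := by
  have := hS.mono_f
  have := hS.epi_g
  let u : S.X₃ ⟶ cokernel (S.f ≫ i) :=
    hS.exact.desc (i ≫ cokernel.π (S.f ≫ i)) (by rw [← assoc, cokernel.condition])
  have hu : S.g ≫ u = i ≫ cokernel.π (S.f ≫ i) := hS.exact.g_desc _ _
  let v : cokernel (S.f ≫ i) ⟶ cokernel i := cokernel.desc _ (cokernel.π i) (by simp)
  have hv : cokernel.π (S.f ≫ i) ≫ v = cokernel.π i := cokernel.π_desc _ _ _
  have w : u ≫ v = 0 := by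
    rw [← cancel_epi S.g, reassoc_of% hu, hv, cokernel.condition, comp_zero]
  have hmono : Mono u := by
    refine Preadditive.mono_of_cancel_zero _ fun {A} y hy => ?_
    obtain ⟨A', π, _, x, hx⟩ := surjective_up_to_refinements_of_epi S.g y
    have hxi : (x ≫ i) ≫ cokernel.π (S.f ≫ i) = 0 := by
      rw [assoc, ← hu, ← reassoc_of% hx, hy, comp_zero]
    obtain ⟨b, hb⟩ : ∃ b, b ≫ S.f ≫ i = x ≫ i :=
      ⟨_, (ShortComplex.exact_cokernel (S.f ≫ i)).lift_f (x ≫ i) hxi⟩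
    rw [← assoc, cancel_mono] at hb
    rw [← cancel_epi π, hx, ← hb]
    simp
  have hepi : Epi v := epi_of_epi_fac hv
  refine ⟨u, v, w, ⟨?_⟩, hv⟩
  rw [ShortComplex.exact_iff_exact_up_to_refinements]
  intro A y hy
  dsimp at y hy ⊢
  obtain ⟨A', π, _, j, hj⟩ := surjective_up_to_refinements_of_epi (cokernel.π (S.f ≫ i)) y
  have hji : j ≫ cokernel.π i = 0 := by
    rw [← hv, ← reassoc_of% hj, hy, comp_zero]
  have hx := (ShortComplex.exact_cokernel i).lift_f j hji
  refine ⟨A', π, inferInstance, (ShortComplex.exact_cokernel i).lift j hji ≫ S.g, ?_⟩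
  rw [hj, assoc, hu, reassoc_of% hx]

lemma exists_injectiveResolution_augment {S : ShortComplex C} (hS : S.ShortExact) [Injective S.X₂]
    (K : CochainComplex C ℕ) (hK : ∀ n, Injective (K.X n)) (e : S.X₃ ⟶ K.X 0) [Mono e]
    (w : e ≫ K.d 0 1 = 0) (he : (ShortComplex.mk e (K.d 0 1) w).Exact)
    (hex : ∀ n, (ShortComplex.mk _ _ (K.d_comp_d n (n + 1) (n + 2))).Exact) :
    ∃ I : InjectiveResolution S.X₁,
      I.cocomplex = K.augment (S.g ≫ e) (by rw [assoc, w, comp_zero]) := by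
  have := hS.mono_f
  have := hS.epi_g
  have w' : (S.g ≫ e) ≫ K.d 0 1 = 0 := by rw [assoc, w, comp_zero]
  let L := K.augment (S.g ≫ e) w'
  have hd : S.f ≫ L.d 0 1 = 0 := by
    change S.f ≫ S.g ≫ e = 0
    simp
  refine ⟨{
    cocomplex := L
    injective := fun n => by
      cases n
      · exact inferInstanceAs (Injective S.X₂)
      · exact hK _
    ι := (CochainComplex.fromSingle₀Equiv _ _).symm ⟨S.f, hd⟩
    quasiIso := ⟨fun n => ?_⟩ }, rfl⟩
  obtain _ | n := n
  · rw [CochainComplex.quasiIsoAt₀_iff, ShortComplex.quasiIso_iff_of_zeros]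
    · have h : (ShortComplex.mk S.f (L.d 0 1) hd).Exact := by
        let φ : S ⟶ ShortComplex.mk S.f (L.d 0 1) hd :=
          { τ₁ := 𝟙 _
            τ₂ := 𝟙 _
            τ₃ := e
            comm₁₂ := by simp
            comm₂₃ := id_comp _ }
        have : Mono φ.τ₃ := inferInstanceAs (Mono e)
        have : Epi φ.τ₁ := inferInstanceAs (Epi (𝟙 _))
        have : IsIso φ.τ₂ := inferInstanceAs (IsIso (𝟙 _))
        exact (ShortComplex.exact_iff_of_epi_of_isIso_of_mono φ).1 hS.exact
      refine (ShortComplex.exact_and_mono_f_iff_of_iso ?_).2 ⟨h, inferInstanceAs (Mono S.f)⟩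
      exact ShortComplex.isoMk (Iso.refl _) (Iso.refl _) (Iso.refl _)
        ((id_comp _).trans
          ((CochainComplex.fromSingle₀Equiv_symm_apply_f_zero (C := L) S.f hd).symm.trans
            (comp_id _).symm))
        ((id_comp _).trans (comp_id _).symm)
    all_goals rfl
  · rw [quasiIsoAt_iff_exactAt]
    · rw [HomologicalComplex.exactAt_iff' _ n (n + 1) (n + 2) (by simp) (by simp)]
      obtain _ | n := n
      · let φ : ShortComplex.mk (S.g ≫ e) (K.d 0 1) w' ⟶ ShortComplex.mk e (K.d 0 1) w :=
          { τ₁ := S.g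
            τ₂ := 𝟙 _
            τ₃ := 𝟙 _ }
        have : Mono φ.τ₃ := inferInstanceAs (Mono (𝟙 _))
        have : Epi φ.τ₁ := inferInstanceAs (Epi S.g)
        have : IsIso φ.τ₂ := inferInstanceAs (IsIso (𝟙 _))
        exact (ShortComplex.exact_iff_of_epi_of_isIso_of_mono φ).2 he
      · exact hex n
    · apply CochainComplex.exactAt_succ_single_obj

end

section

variable {C : Type*} [Category C] [Abelian C] [EnoughInjectives C]
  {D : Type*} [Category D] [Abelian D] (G : C ⥤ D) [G.Additive]

lemma exists_shortExact_injective {S : ShortComplex C} (hS : S.ShortExact) :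
    ∃ (T : ShortComplex C) (φ : S ⟶ T), T.ShortExact ∧ Injective T.X₂ ∧ IsIso φ.τ₁ := by
  have := hS.mono_f
  have := hS.epi_g
  let T := ShortComplex.mk (Injective.ι S.X₁) (cokernel.π _) (cokernel.condition _)
  let b : S.X₂ ⟶ T.X₂ := Injective.factorThru (Injective.ι S.X₁) S.f
  have hb : S.f ≫ b = T.f := Injective.comp_factorThru _ _
  let φ : S ⟶ T :=
    { τ₁ := 𝟙 _
      τ₂ := b
      τ₃ := hS.exact.desc (b ≫ T.g) (by rw [reassoc_of% hb, T.zero])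
      comm₁₂ := by rw [hb]; exact id_comp _
      comm₂₃ := (hS.exact.g_desc _ _).symm }
  exact ⟨T, φ, ⟨ShortComplex.exact_cokernel _⟩, inferInstanceAs (Injective (Injective.under _)),
    inferInstanceAs (IsIso (𝟙 _))⟩

instance injectiveResolutions_additive : (injectiveResolutions C).Additive where
  map_add {X Y f g} := by
    refine Eq.trans ?_ (HomotopyCategory.quotient C _).map_add
    apply HomotopyCategory.eq_of_homotopy
    apply InjectiveResolution.descHomotopy (f + g)
    · exact InjectiveResolution.desc_commutes _ _ _
    · simp [InjectiveResolution.desc_commutes, Functor.map_add]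

instance rightDerived_additive (n : ℕ) : (G.rightDerived n).Additive :=
  inferInstanceAs (injectiveResolutions C ⋙ G.mapHomotopyCategory _ ⋙
    HomotopyCategory.homologyFunctor D _ n).Additive

lemma rightDerived_one_iso_of_injective [PreservesFiniteLimits G] {S : ShortComplex C}
    (hS : S.ShortExact) [Injective S.X₂] :
    Nonempty ((G.rightDerived 1).obj S.X₁ ≅ cokernel (G.map S.g)) := by
  let J := InjectiveResolution.of S.X₃
  let e : S.X₃ ⟶ J.cocomplex.X 0 := J.ι.f 0
  have : Mono e := inferInstanceAs (Mono (J.ι.f 0))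
  obtain ⟨I, hI⟩ := exists_injectiveResolution_augment hS J.cocomplex J.injective e
    J.ι_f_zero_comp_complex_d J.exact₀ J.exact_succ
  refine ⟨I.isoRightDerivedObj G 1 ≪≫ Nonempty.some ?_⟩
  rw [hI]
  have := J.exact₀.map_of_mono_of_preservesKernel G (inferInstanceAs (Mono (J.ι.f 0))) inferInstance
  exact homology_iso_cokernel_of_kernel
    ((G.mapHomologicalComplex _).obj (J.cocomplex.augment (S.g ≫ e) _)) 0 (G.map S.g) (G.map e)
    (G.map_mono e) (G.map_comp _ _).symm _ rfl _ ‹_›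

lemma rightDerived_succ_iso_of_injective {S : ShortComplex C} (hS : S.ShortExact)
    [Injective S.X₂] (n : ℕ) :
    Nonempty ((G.rightDerived (n + 2)).obj S.X₁ ≅ (G.rightDerived (n + 1)).obj S.X₃) := by
  let J := InjectiveResolution.of S.X₃
  let e : S.X₃ ⟶ J.cocomplex.X 0 := J.ι.f 0
  have : Mono e := inferInstanceAs (Mono (J.ι.f 0))
  obtain ⟨I, hI⟩ := exists_injectiveResolution_augment hS J.cocomplex J.injective e
    J.ι_f_zero_comp_complex_d J.exact₀ J.exact_succ
  refine ⟨I.isoRightDerivedObj G (n + 2) ≪≫ Nonempty.some ?_ ≪≫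
    (J.isoRightDerivedObj G (n + 1)).symm⟩
  rw [hI]
  exact ⟨HomologicalComplex.homologyIsoSc' _ (n + 1) (n + 2) (n + 3) (by simp) (by simp) ≪≫
    (HomologicalComplex.homologyIsoSc' ((G.mapHomologicalComplex _).obj J.cocomplex)
      n (n + 1) (n + 2) (by simp) (by simp)).symm⟩

lemma rightDerived_succ_iso_of_forall {S : ShortComplex C} (hS : S.ShortExact)
    (h : ∀ j, IsZero ((G.rightDerived (j + 1)).obj S.X₂)) (n : ℕ)
    (H : ∀ T : ShortComplex C, T.ShortExact →
      (∀ j, IsZero ((G.rightDerived (j + 1)).obj T.X₁)) →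
      Nonempty ((G.rightDerived (n + 1)).obj T.X₂ ≅ (G.rightDerived (n + 1)).obj T.X₃)) :
    Nonempty ((G.rightDerived (n + 2)).obj S.X₁ ≅ (G.rightDerived (n + 1)).obj S.X₃) := by
  obtain ⟨T, φ, hT, _, _⟩ := exists_shortExact_injective hS
  obtain ⟨α⟩ := rightDerived_succ_iso_of_injective G hT n
  obtain ⟨β⟩ := H _ (shortExact_biprod_of_shortExact hS hT φ) h
  have := preservesBinaryBiproducts_of_preservesBiproducts (G.rightDerived (n + 1))
  exact ⟨(G.rightDerived (n + 2)).mapIso (asIso φ.τ₁) ≪≫ α ≪≫ β.symm ≪≫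
    (G.rightDerived (n + 1)).mapBiprod T.X₂ S.X₃ ≪≫
    (isoZeroBiprod (G.isZero_rightDerived_obj_injective_succ n T.X₂)).symm⟩

variable [PreservesFiniteLimits G]

lemma epi_map_of_isZero_rightDerived_one {S : ShortComplex C} (hS : S.ShortExact)
    (h : IsZero ((G.rightDerived 1).obj S.X₁)) : Epi (G.map S.g) := by
  obtain ⟨T, φ, hT, _, _⟩ := exists_shortExact_injective hS
  obtain ⟨α⟩ := rightDerived_one_iso_of_injective G hT
  have : Epi (G.map T.g) := Preadditive.epi_of_isZero_cokernel _
    (h.of_iso (α.symm ≪≫ (G.rightDerived 1).mapIso (asIso φ.τ₁).symm))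
  exact MorphismProperty.of_isPullback (P := .epimorphisms D)
    ((isPullback_of_shortExact hS hT φ).map G) this

lemma rightDerived_one_iso_cokernel {S : ShortComplex C} (hS : S.ShortExact)
    (h : IsZero ((G.rightDerived 1).obj S.X₂)) :
    Nonempty ((G.rightDerived 1).obj S.X₁ ≅ cokernel (G.map S.g)) := by
  obtain ⟨T, φ, hT, _, _⟩ := exists_shortExact_injective hS
  have sq := (isPullback_of_shortExact hS hT φ).flip
  have hepi := epi_map_of_isZero_rightDerived_one G (shortExact_biprod_of_shortExact hS hT φ) h
  dsimp at hepi
  have : Epi (cokernel.map (G.map S.g) (G.map T.g) _ _ (sq.map G).w) := by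
    refine Preadditive.epi_of_cancel_zero _ fun {A} z hz => ?_
    have hz' : G.map φ.τ₃ ≫ cokernel.π (G.map T.g) ≫ z = 0 := by
      simpa using cokernel.π (G.map S.g) ≫= hz
    rw [← cancel_epi (cokernel.π (G.map T.g)), comp_zero,
      ← cancel_epi (G.map (biprod.desc T.g (-φ.τ₃))), biprod.desc_eq]
    simp [hz']
  have := Abelian.mono_cokernel_map_of_isPullback (sq.map G)
  have := isIso_of_mono_of_epi (cokernel.map (G.map S.g) (G.map T.g) _ _ (sq.map G).w)
  obtain ⟨α⟩ := rightDerived_one_iso_of_injective G hT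
  exact ⟨(G.rightDerived 1).mapIso (asIso φ.τ₁) ≪≫ α ≪≫
    (asIso (cokernel.map _ _ _ _ (sq.map G).w)).symm⟩

lemma exists_shortExact_of_acyclic {S : ShortComplex C} (hS : S.ShortExact)
    (h : ∀ j, IsZero ((G.rightDerived (j + 1)).obj S.X₁)) :
    ∃ T : ShortComplex C, T.ShortExact ∧ T.X₁ = S.X₃ ∧
      (∀ j, IsZero ((G.rightDerived (j + 1)).obj T.X₂)) ∧
      Nonempty ((G.rightDerived 1).obj S.X₂ ≅ cokernel (G.map T.g)) ∧
      ∀ n, Nonempty ((G.rightDerived (n + 2)).obj S.X₂ ≅ (G.rightDerived (n + 1)).obj T.X₃) := by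
  have := hS.mono_f
  let i := Injective.ι S.X₂
  obtain ⟨u, v, w, hT, hv⟩ := shortExact_cokernel_comp hS i
  have hB : (ShortComplex.mk (S.f ≫ i) (cokernel.π _) (cokernel.condition _)).ShortExact :=
    ⟨ShortComplex.exact_cokernel _⟩
  have hX : (ShortComplex.mk i (cokernel.π _) (cokernel.condition _)).ShortExact :=
    ⟨ShortComplex.exact_cokernel _⟩
  have : Injective (ShortComplex.mk (S.f ≫ i) (cokernel.π _) (cokernel.condition _)).X₂ :=
    inferInstanceAs (Injective (Injective.under _))
  have : Injective (ShortComplex.mk i (cokernel.π _) (cokernel.condition _)).X₂ :=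
    inferInstanceAs (Injective (Injective.under _))
  have hepi : Epi (G.map (cokernel.π (S.f ≫ i))) :=
    epi_map_of_isZero_rightDerived_one G hB (h 0)
  refine ⟨_, hT, rfl, fun j => ?_, ?_, rightDerived_succ_iso_of_injective G hX⟩
  · obtain ⟨α⟩ := rightDerived_succ_iso_of_injective G hB j
    exact (h (j + 1)).of_iso α.symm
  · obtain ⟨α⟩ := rightDerived_one_iso_of_injective G hX
    exact ⟨α ≪≫ cokernelIsoOfEq (by rw [← G.map_comp, hv]) ≪≫
      cokernelEpiComp (G.map (cokernel.π (S.f ≫ i))) (G.map v)⟩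

lemma rightDerived_succ_iso_of_acyclic_left (n : ℕ) : ∀ {S : ShortComplex C}, S.ShortExact →
    (∀ j, IsZero ((G.rightDerived (j + 1)).obj S.X₁)) →
    Nonempty ((G.rightDerived (n + 1)).obj S.X₂ ≅ (G.rightDerived (n + 1)).obj S.X₃) := by
  induction n with
  | zero =>
    intro S hS h
    obtain ⟨T, hT, hX, hB, ⟨α⟩, -⟩ := exists_shortExact_of_acyclic G hS h
    obtain ⟨β⟩ := rightDerived_one_iso_cokernel G hT (hB 0)
    exact ⟨α ≪≫ β.symm ≪≫ eqToIso (by rw [hX])⟩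
  | succ n ih =>
    intro S hS h
    obtain ⟨T, hT, hX, hB, -, hs⟩ := exists_shortExact_of_acyclic G hS h
    obtain ⟨β⟩ := rightDerived_succ_iso_of_forall G hT hB n fun _ => ih
    exact ⟨(hs n).some ≪≫ β.symm ≪≫ eqToIso (by rw [hX])⟩

lemma rightDerived_succ_iso_of_acyclic {S : ShortComplex C} (hS : S.ShortExact)
    (h : ∀ j, IsZero ((G.rightDerived (j + 1)).obj S.X₂)) (n : ℕ) :
    Nonempty ((G.rightDerived (n + 2)).obj S.X₁ ≅ (G.rightDerived (n + 1)).obj S.X₃) :=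
  rightDerived_succ_iso_of_forall G hS h n
    fun _ => rightDerived_succ_iso_of_acyclic_left G n

lemma rightDerived_succ_iso_cokernel (p : ℕ) (S S' : ℕ → C) (a : ∀ i, S i ⟶ S' i)
    (b : ∀ i, i < p → (S' i ⟶ S (i + 1))) (w : ∀ i hi, a i ≫ b i hi = 0)
    (hS : ∀ i hi, (ShortComplex.mk (a i) (b i hi) (w i hi)).ShortExact)
    (h : ∀ i, i < p → ∀ j, IsZero ((G.rightDerived (j + 1)).obj (S' i))) (q : ℕ) (hq : q < p) :
    Nonempty ((G.rightDerived (q + 1)).obj (S 0) ≅ cokernel (G.map (b q hq))) := by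
  have H (i : ℕ) (hi : i < p) :
      ∀ n m, m = i + n + 1 →
        Nonempty ((G.rightDerived m).obj (S 0) ≅ (G.rightDerived (n + 1)).obj (S i)) := by
    induction i with
    | zero =>
      rintro n _ rfl
      exact ⟨eqToIso (by rw [zero_add])⟩
    | succ i ih =>
      rintro n m hm
      obtain ⟨α⟩ := ih (by lia) (n + 1) m (by lia)
      obtain ⟨β⟩ := rightDerived_succ_iso_of_acyclic G (hS i (by lia)) (h i (by lia)) n
      exact ⟨α ≪≫ β⟩
  obtain ⟨α⟩ := H q hq 0 (q + 1) rfl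
  obtain ⟨β⟩ := rightDerived_one_iso_cokernel G (hS q hq) (h q hq 0)
  exact ⟨α ≪≫ β⟩

end

section

variable {C : Type*} [Category C] [Abelian C] {D : Type*} [Category D] [Abelian D]
  (G : C ⥤ D) [G.Additive]

lemma globalSectionsComplex_d (p : ℕ) (S' : ℕ → C) (f : ∀ i, S' i ⟶ S' (i + 1))
    (hw : ∀ i, i + 1 ≤ p → f i ≫ f (i + 1) = 0) {q : ℕ} (hq : q ≤ p) :
    (globalSectionsComplex G p S' f hw).d q (q + 1) = G.map (f q) :=
  (CochainComplex.of_d (fun q => G.obj (S' q))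
    (fun q => if q ≤ p then G.map (f q) else 0) q).trans (if_pos hq)

end

end

/-- **Theorem (abstract de Rham theorem).**  Let
`0 → S →^h S₀ → S₁ → ⋯ → S_p → S_{p+1}`, `p > 1`, be an exact sequence
(`hmono`, `hex0`, `hex`) in an abelian category `C` with enough injectives
(e.g. the category of sheaves of Abelian groups over a paracompact topological
space `Z`), let `G : C ⥤ D` be an additive left exact functor to an abelian
category (e.g. the global sections functor `Γ(Z, ·)`), and suppose the objects
`S_q`, `0 ≤ q < p`, are acyclic, i.e. `(G.rightDerived j).obj (S' q) = 0` for
`j > 0` (`hacyclic`).  Then, for `0 ≤ q ≤ p`, the `q`-th cohomology group of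
the cochain complex of global sections is isomorphic to the cohomology
`H^q(Z, S) = (G.rightDerived q).obj S` with coefficients in `S`. -/
theorem abstract_deRham_theorem
    {C : Type*} [Category C] [Abelian C] [EnoughInjectives C]
    {D : Type*} [Category D] [Abelian D]
    (G : C ⥤ D) [G.Additive] [Limits.PreservesFiniteLimits G]
    (p : ℕ) (hp : 1 < p)
    (S : C) (S' : ℕ → C) (h : S ⟶ S' 0) (f : ∀ i, S' i ⟶ S' (i + 1))
    (hmono : Mono h)
    (hw0 : h ≫ f 0 = 0)
    (hw : ∀ i, i + 1 ≤ p → f i ≫ f (i + 1) = 0)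
    (hex0 : (ShortComplex.mk h (f 0) hw0).Exact)
    (hex : ∀ i (hi : i + 1 ≤ p), (ShortComplex.mk (f i) (f (i + 1)) (hw i hi)).Exact)
    (hacyclic : ∀ q, q < p → ∀ j, 0 < j → Limits.IsZero ((G.rightDerived j).obj (S' q))) :
    ∀ q, q ≤ p →
      Nonempty ((globalSectionsComplex G p S' f hw).homology q ≅
        (G.rightDerived q).obj S) := by
  let K (i : ℕ) : C := Limits.kernel (f i)
  let b (i : ℕ) (hi : i < p) : S' i ⟶ K (i + 1) := Limits.kernel.lift _ (f i) (hw i hi)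
  have hb (i : ℕ) (hi : i < p) : b i hi ≫ Limits.kernel.ι (f (i + 1)) = f i :=
    Limits.kernel.lift_ι _ _ _
  have w (i : ℕ) (hi : i < p) : Limits.kernel.ι (f i) ≫ b i hi = 0 := by
    rw [← cancel_mono (Limits.kernel.ι (f (i + 1))), Category.assoc, hb i hi,
      Limits.kernel.condition, Limits.zero_comp]
  intro q hq
  obtain _ | q := q
  · have hex' := hex0.map_of_mono_of_preservesKernel G hmono inferInstance
    obtain ⟨α⟩ := homology_zero_iso_of_kernel (globalSectionsComplex G p S' f hw) (G.map h)
      (G.map_mono h) (G.map (f 0)) (globalSectionsComplex_d G p S' f hw p.zero_le) _ hex'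
    exact ⟨α ≪≫ (G.rightDerivedZeroIsoSelf.app S).symm⟩
  · obtain ⟨α⟩ := rightDerived_succ_iso_cokernel G p K S' (fun i => Limits.kernel.ι (f i)) b w
      (fun i hi => shortExact_kernelLift_of_exact (hex i hi))
      (fun i hi j => hacyclic i hi (j + 1) j.succ_pos) q hq
    have hex' := (ShortComplex.exact_kernel (f (q + 1))).map_of_mono_of_preservesKernel G
      inferInstance inferInstance
    obtain ⟨β⟩ := homology_iso_cokernel_of_kernel (globalSectionsComplex G p S' f hw) q
      (G.map (b q hq)) (G.map (Limits.kernel.ι (f (q + 1)))) (G.map_mono _)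
      ((G.map_comp _ _).symm.trans ((congrArg G.map (hb q hq)).trans
        (globalSectionsComplex_d G p S' f hw (by lia)).symm))
      (G.map (f (q + 1))) (globalSectionsComplex_d G p S' f hw hq) _ hex'
    let e : S ≅ K 0 := hex0.fIsKernel.conePointUniqueUpToIso (Limits.limit.isLimit _)
    exact ⟨β ≪≫ α.symm ≪≫ (G.rightDerived (q + 1)).mapIso e.symm⟩
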